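/- arXiv:1303.0862 — 2 statements merged into one kernel-verified Lean document; each statement's English description precedes it below -/
import Mathlib

section
/- There is a primitive recursive function f with the following property: for every oracle A ∈ ℕ^ℕ and every index e, one can find, effectively in e, an A-recursive treemap F: T_e^{A'} → T_{f(e)}^A which induces a homeomorphism of P_e^{A'} onto P_{f(e)}^A, and such that X ⊕ A ≡_T F(X) ⊕ A uniformly for all X ∈ P_e^{A'}. -/
namespace Harrington

open scoped Classical

/-- Codes for oracle Turing machines (partial recursive functionals),
    extending `Nat.Partrec.Code` with an `oracle` constructor. -/
inductive OCode : Type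
  | zero : OCode
  | succ : OCode
  | left : OCode
  | right : OCode
  | oracle : OCode
  | pair : OCode → OCode → OCode
  | comp : OCode → OCode → OCode
  | prec : OCode → OCode → OCode
  | rfind' : OCode → OCode

/-- Evaluation of an oracle code relative to a (total) oracle `A`. -/
def evalo (A : ℕ → ℕ) : OCode → ℕ →. ℕ
  | OCode.zero => pure 0
  | OCode.succ => fun n => Part.some (n + 1)
  | OCode.left => fun n => Part.some (Nat.unpair n).1
  | OCode.right => fun n => Part.some (Nat.unpair n).2
  | OCode.oracle => fun n => Part.some (A n)
  | OCode.pair cf cg => fun n => Nat.pair <$> evalo A cf n <*> evalo A cg n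
  | OCode.comp cf cg => fun n => evalo A cg n >>= evalo A cf
  | OCode.prec cf cg =>
    Nat.unpaired fun a n =>
      n.rec (evalo A cf a) fun y IH => do
        let i ← IH
        evalo A cg (Nat.pair a (Nat.pair y i))
  | OCode.rfind' cf =>
    Nat.unpaired fun a m =>
      (Nat.rfind fun n => (fun x => x = 0) <$> evalo A cf (Nat.pair a (n + m))).map (· + m)

/-- The standard enumeration of oracle codes: `OCode.ofNat e` is the `e`-th oracle machine. -/
def OCode.ofNat : ℕ → OCode
  | 0 => OCode.zero
  | 1 => OCode.succ
  | 2 => OCode.left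
  | 3 => OCode.right
  | 4 => OCode.oracle
  | n + 5 =>
    have hm : n.div2.div2 < n + 5 := by
      have h1 : n.div2.div2 ≤ n := by
        simp only [Nat.div2_val]
        exact le_trans (Nat.div_le_self _ _) (Nat.div_le_self _ _)
      omega
    have _m1 : n.div2.div2.unpair.1 < n + 5 := lt_of_le_of_lt (Nat.unpair_left_le _) hm
    have _m2 : n.div2.div2.unpair.2 < n + 5 := lt_of_le_of_lt (Nat.unpair_right_le _) hm
    match n.bodd, n.div2.bodd with
    | false, false => OCode.pair (OCode.ofNat n.div2.div2.unpair.1) (OCode.ofNat n.div2.div2.unpair.2)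
    | false, true  => OCode.comp (OCode.ofNat n.div2.div2.unpair.1) (OCode.ofNat n.div2.div2.unpair.2)
    | true,  false => OCode.prec (OCode.ofNat n.div2.div2.unpair.1) (OCode.ofNat n.div2.div2.unpair.2)
    | true,  true  => OCode.rfind' (OCode.ofNat n.div2.div2)

/-- The Turing jump `A'` of an oracle `A`:  `A'(e) = 1` if the `e`-th machine with
    oracle `A` halts on input `e`, and `A'(e) = 0` otherwise. -/
noncomputable def jump (A : ℕ → ℕ) : ℕ → ℕ :=
  fun e => if (evalo A (OCode.ofNat e) e).Dom then 1 else 0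

/-- Iterated Turing jump `A^{(n)}`. -/
noncomputable def jumpIter (A : ℕ → ℕ) : ℕ → (ℕ → ℕ)
  | 0 => A
  | n + 1 => jump (jumpIter A n)

/-- The constant zero function (the trivial oracle `0`). -/
def zeroF : ℕ → ℕ := fun _ => 0

/-- The `ω`-jump: `X^{(ω)} = {(i,n) : i ∈ X^{(n)}}`, coded via `Nat.pair` and identified
    with its characteristic function. -/
noncomputable def omegaJump (A : ℕ → ℕ) : ℕ → ℕ :=
  fun m => if jumpIter A m.unpair.2 m.unpair.1 ≠ 0 then 1 else 0

/-- The recursive join `A ⊕ B`. -/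
def oplus (A B : ℕ → ℕ) : ℕ → ℕ :=
  fun n => if n % 2 = 0 then A (n / 2) else B (n / 2)

/-- Code `c` computes the total function `f` from oracle `A`. -/
def computesFn (A : ℕ → ℕ) (c : OCode) (f : ℕ → ℕ) : Prop :=
  ∀ n, evalo A c n = Part.some (f n)

/-- Turing reducibility `X ≤_T A` for points of Baire space. -/
def TRedIn (X A : ℕ → ℕ) : Prop := ∃ c : OCode, computesFn A c X

/-- `X` is arithmetical relative to `Y`: `X ≤_T Y^{(n)}` for some `n`. -/
def ArithIn (X Y : ℕ → ℕ) : Prop := ∃ n : ℕ, TRedIn X (jumpIter Y n)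

/-- `X` and `Y` are arithmetically equivalent. -/
def ArithEquiv (X Y : ℕ → ℕ) : Prop := ArithIn X Y ∧ ArithIn Y X

/-! ### Strings and trees -/

/-- Strings: finite sequences of natural numbers. -/
abbrev Str := List ℕ

/-- The initial segment `X↾n` of a point `X` of Baire space. -/
def initSeg (X : ℕ → ℕ) (n : ℕ) : Str := (List.range n).map X

/-- A tree is a set of strings closed under initial segments. -/
def IsTree (T : Set Str) : Prop := ∀ σ τ : Str, σ <+: τ → τ ∈ T → σ ∈ T

/-- `[T]`, the set of paths through `T`. -/
def paths (T : Set Str) : Set (ℕ → ℕ) := {X | ∀ n, initSeg X n ∈ T}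

/-- The characteristic function of a set of strings. -/
noncomputable def chi (T : Set Str) : Str → ℕ := fun σ => if σ ∈ T then 1 else 0

/-- A set of strings is `A`-recursive: its characteristic function is computable from `A`. -/
def SetRecIn (A : ℕ → ℕ) (T : Set Str) : Prop :=
  ∃ c : OCode, ∀ σ : Str, evalo A c (Encodable.encode σ) = Part.some (chi T σ)

/-- `P ⊆ ℕ^ℕ` is `Π^{0,A}_1` : `P = [T]` for some `A`-recursive tree `T`. -/
def IsPi01In (A : ℕ → ℕ) (P : Set (ℕ → ℕ)) : Prop :=
  ∃ T : Set Str, IsTree T ∧ SetRecIn A T ∧ P = paths T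

/-- `P ⊆ ℕ^ℕ` is `Π⁰₁` : `P = [T]` for some recursive tree `T`. -/
def IsPi01 (P : Set (ℕ → ℕ)) : Prop := IsPi01In zeroF P

/-! ### Treemaps -/

/-- `F` is a treemap on the tree `T`: `F(σ⌢⟨i⟩) ⊇ F(σ)⌢⟨i⟩` whenever `σ⌢⟨i⟩ ∈ T`. -/
def IsTreemapOn (T : Set Str) (F : Str → Str) : Prop :=
  ∀ (σ : Str) (i : ℕ), σ ++ [i] ∈ T → (F σ) ++ [i] <+: F (σ ++ [i])

/-- The image tree `F(T) = {τ : ∃ σ ∈ T, τ ⊆ F(σ)}`. -/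
def treeImage (F : Str → Str) (T : Set Str) : Set Str :=
  {τ | ∃ σ ∈ T, τ <+: F σ}

/-- The map on paths induced by a treemap: `X ↦ ⋃ₙ F(X↾n)`. -/
def pathMap (F : Str → Str) (X : ℕ → ℕ) : ℕ → ℕ :=
  fun i => (F (initSeg X (i + 1))).getD i 0

/-- The string function `F` is `A`-recursive on `T` (restriction of a partial
    `A`-recursive function). -/
def FnRecInOn (A : ℕ → ℕ) (F : Str → Str) (T : Set Str) : Prop :=
  ∃ c : OCode, ∀ σ ∈ T, evalo A c (Encodable.encode σ) = Part.some (Encodable.encode (F σ))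

/-- `F` maps `P` homeomorphically onto `Q` (subspace topologies from Baire space). -/
def HomeoOn (F : (ℕ → ℕ) → (ℕ → ℕ)) (P Q : Set (ℕ → ℕ)) : Prop :=
  Set.BijOn F P Q ∧ ContinuousOn F P ∧
    ∃ G : (ℕ → ℕ) → (ℕ → ℕ), Set.InvOn G F P Q ∧ ContinuousOn G Q

/-- `f X ≡_T g X` uniformly for all `X ∈ P`: the Turing reductions are given by
    fixed indices independent of `X`. -/
def UnifEquivOn (P : Set (ℕ → ℕ)) (f g : (ℕ → ℕ) → (ℕ → ℕ)) : Prop :=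
  ∃ c d : OCode, ∀ X ∈ P, computesFn (g X) c (f X) ∧ computesFn (f X) d (g X)

/-! ### Standard enumerations -/

/-- `W_e^A`: the `e`-th `A`-recursively enumerable set of strings. -/
def WA (A : ℕ → ℕ) (e : ℕ) : Set Str :=
  {σ | (evalo A (OCode.ofNat e) (Encodable.encode σ)).Dom}

/-- `T_e^A = {σ : ∀ n ≤ |σ|, σ↾n ∉ W_e^A}`: the standard enumeration of `Π^{0,A}_1` trees. -/
def TA (A : ℕ → ℕ) (e : ℕ) : Set Str :=
  {σ | ∀ n ≤ σ.length, σ.take n ∉ WA A e}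

/-- `P_e^A = [T_e^A]`: the standard enumeration of `Π^{0,A}_1` subsets of Baire space. -/
def PA (A : ℕ → ℕ) (e : ℕ) : Set (ℕ → ℕ) := paths (TA A e)

/-! ### The arithmetical hierarchy on Baire space -/

/-- Prepend a number to a point of Baire space. -/
def consF (k : ℕ) (X : ℕ → ℕ) : ℕ → ℕ := fun i => Nat.casesOn i k fun j => X j

/-- `Σ⁰ₙ` subsets of Baire space.  `Σ⁰₀` sets are the recursive clopen sets
    (depending computably on a fixed finite initial segment), and
    `Σ⁰ₙ₊₁` sets are obtained from `Π⁰ₙ` sets by existential number quantification. -/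
def SigmaN : ℕ → Set (ℕ → ℕ) → Prop
  | 0, P => ∃ (k : ℕ) (f : Str → Bool), Computable f ∧ P = {X | f (initSeg X k) = true}
  | n + 1, P => ∃ Q : Set (ℕ → ℕ), SigmaN n Qᶜ ∧ P = {X | ∃ k : ℕ, consF k X ∈ Q}

/-- `Π⁰ₙ` subsets of Baire space: complements of `Σ⁰ₙ` sets. -/
def PiN (n : ℕ) (P : Set (ℕ → ℕ)) : Prop := SigmaN n Pᶜ

/-- Arithmetical subsets of Baire space: `Π⁰ₙ` for some `n`. -/
def IsArith (P : Set (ℕ → ℕ)) : Prop := ∃ n : ℕ, PiN n P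

open Nat.Partrec (Code)

/-! ### Computing with oracle codes -/

/-- The oracle code simulating an ordinary code. -/
def OCode.ofCode : Code → OCode
  | .zero => .zero
  | .succ => .succ
  | .left => .left
  | .right => .right
  | .pair c d => .pair (ofCode c) (ofCode d)
  | .comp c d => .comp (ofCode c) (ofCode d)
  | .prec c d => .prec (ofCode c) (ofCode d)
  | .rfind' c => .rfind' (ofCode c)

theorem evalo_ofCode (A : ℕ → ℕ) (c : Code) : evalo A (OCode.ofCode c) = c.eval := by
  induction c with
  | zero => rfl
  | succ => rfl
  | left => rfl
  | right => rfl
  | pair c d hc hd => simp only [OCode.ofCode, evalo, Code.eval, hc, hd]; rfl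
  | comp c d hc hd => simp only [OCode.ofCode, evalo, Code.eval, hc, hd]; rfl
  | prec c d hc hd => simp only [OCode.ofCode, evalo, Code.eval, hc, hd]; rfl
  | rfind' c hc => simp only [OCode.ofCode, evalo, Code.eval, hc]; rfl

theorem exists_computesFn_of_primrec {f : ℕ → ℕ} (hf : Primrec f) :
    ∃ c : OCode, ∀ A, computesFn A c f := by
  obtain ⟨c, hc⟩ := Code.exists_code.1 (Nat.Partrec.of_primrec (Primrec.nat_iff.1 hf))
  exact ⟨OCode.ofCode c, fun A n => by rw [evalo_ofCode, hc]; rfl⟩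

theorem evalo_pair_eq (A : ℕ → ℕ) (c d : OCode) (n : ℕ) : evalo A (.pair c d) n =
    (evalo A c n).bind fun x => (evalo A d n).map (Nat.pair x) := by
  simp only [evalo, Seq.seq]
  exact Part.bind_map _ _ _

theorem evalo_comp_eq (A : ℕ → ℕ) (c d : OCode) (n : ℕ) :
    evalo A (.comp c d) n = (evalo A d n).bind fun x => evalo A c x := rfl

theorem evalo_pair {A : ℕ → ℕ} {c d : OCode} {n x y : ℕ} (hc : evalo A c n = Part.some x)
    (hd : evalo A d n = Part.some y) : evalo A (.pair c d) n = Part.some (Nat.pair x y) := by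
  rw [evalo_pair_eq, hc, hd, Part.bind_some, Part.map_some]

theorem evalo_comp {A : ℕ → ℕ} {c d : OCode} {n x : ℕ} (hd : evalo A d n = Part.some x) :
    evalo A (.comp c d) n = evalo A c x := by
  rw [evalo_comp_eq, hd, Part.bind_some]

theorem initSeg_succ (X : ℕ → ℕ) (n : ℕ) : initSeg X (n + 1) = initSeg X n ++ [X n] := by
  simp [initSeg, List.range_succ]

/-- A code computing `k ↦ A↾k` (as a coded string) from the oracle `A`. -/
theorem exists_code_initSeg :
    ∃ c : OCode, ∀ A, computesFn A c fun k => Encodable.encode (initSeg A k) := by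
  have happ : Primrec fun n : ℕ =>
      Encodable.encode (Denumerable.ofNat (List ℕ) n.unpair.1 ++ [n.unpair.2]) :=
    Primrec.encode.comp (Primrec.list_concat.comp
      ((Primrec.ofNat _).comp (Primrec.fst.comp Primrec.unpair)) (Primrec.snd.comp Primrec.unpair))
  obtain ⟨p, hp⟩ := exists_computesFn_of_primrec happ
  obtain ⟨i, hi⟩ := exists_computesFn_of_primrec
    ((Primrec₂.natPair.comp (Primrec.const 0) Primrec.id) : Primrec fun n => Nat.pair 0 n)
  let y : OCode := .comp .left .right
  let r : OCode := .comp .right .right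
  let s : OCode := .comp p (.pair r (.comp .oracle y))
  refine ⟨.comp (.prec .zero s) i, fun A k => ?_⟩
  rw [evalo_comp (hi A k)]
  have hs : ∀ a y r, evalo A s (Nat.pair a (Nat.pair y r)) =
      Part.some (Encodable.encode (Denumerable.ofNat (List ℕ) r ++ [A y])) := by
    intro a y r
    have h1 : evalo A (.pair (.comp .right .right) (.comp .oracle (.comp .left .right)))
        (Nat.pair a (Nat.pair y r)) = Part.some (Nat.pair r (A y)) := by
      refine evalo_pair ?_ ?_ <;> simp [evalo]
    rw [evalo_comp h1, hp A]
    simp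
  induction k with
  | zero => simp [evalo, initSeg]; rfl
  | succ k ih =>
    simp only [evalo, Nat.unpaired, Nat.unpair_pair] at ih ⊢
    rw [ih]
    simp [hs, initSeg_succ]

/-- Every `A`-computable search whose matrix is a primitive recursive function of an initial segment
of the oracle is carried out by a single code, uniformly in `A`. -/
theorem exists_code_rfindOpt {h : ℕ → Str → Option ℕ} (hh : Primrec₂ h) :
    ∃ c : OCode, ∀ A x, evalo A c x = Nat.rfindOpt fun k => h x (initSeg A k) := by
  obtain ⟨s, hs⟩ := exists_code_initSeg
  have hm : Primrec fun n : ℕ => h n.unpair.1 (Denumerable.ofNat (List ℕ) n.unpair.2) :=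
    hh.comp (Primrec.fst.comp Primrec.unpair)
      ((Primrec.ofNat _).comp (Primrec.snd.comp Primrec.unpair))
  obtain ⟨p, hp⟩ := exists_computesFn_of_primrec
    (Primrec.cond (Primrec.option_isSome.comp hm) (Primrec.const 0) (Primrec.const 1))
  obtain ⟨o, ho⟩ := exists_computesFn_of_primrec
    (Primrec.option_getD.comp hm (Primrec.const 0))
  obtain ⟨i, hi⟩ := exists_computesFn_of_primrec
    ((Primrec₂.natPair.comp Primrec.id (Primrec.const 0)) : Primrec fun n => Nat.pair n 0)
  have hq : ∀ A x k, evalo A (.pair .left (.comp s .right)) (Nat.pair x k) =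
      Part.some (Nat.pair x (Encodable.encode (initSeg A k))) := by
    intro A x k
    refine evalo_pair (by simp [evalo]) ?_
    rw [evalo_comp (x := k) (by simp [evalo]), hs A]
  have htest : ∀ A x k, evalo A (.comp p (.pair .left (.comp s .right))) (Nat.pair x k) =
      Part.some (bif (h x (initSeg A k)).isSome then 0 else 1) := by
    intro A x k
    rw [evalo_comp (hq A x k), hp A]
    simp
  have hout : ∀ A x k, evalo A (.comp o (.pair .left (.comp s .right))) (Nat.pair x k) =
      Part.some ((h x (initSeg A k)).getD 0) := by
    intro A x k
    rw [evalo_comp (hq A x k), ho A]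
    simp
  generalize OCode.comp p (.pair .left (.comp s .right)) = t at htest
  generalize OCode.comp o (.pair .left (.comp s .right)) = v at hout
  refine ⟨.comp v (.pair (.comp .left i) (.comp (.rfind' t) i)), fun A x => ?_⟩
  have hleft : evalo A (.comp .left i) x = Part.some x := by
    rw [evalo_comp (hi A x)]; simp [evalo]
  have hfind : evalo A (.comp (.rfind' t) i) x =
      Nat.rfind fun k => Part.some (h x (initSeg A k)).isSome := by
    rw [evalo_comp (hi A x)]
    simp only [evalo, Nat.unpaired, Nat.unpair_pair, Nat.add_zero, htest]
    refine (Part.map_id' (fun _ => rfl) _).trans ?_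
    congr 1
    funext k
    cases h x (initSeg A k) <;> simp
  have hv : evalo A (.comp v (.pair (.comp .left i) (.comp (.rfind' t) i))) x =
      (evalo A (.comp (.rfind' t) i) x).bind fun k => evalo A v (Nat.pair x k) := by
    rw [evalo_comp_eq, evalo_pair_eq, hleft, Part.bind_some, Part.bind_map]
  rw [hv, hfind, Nat.rfindOpt]
  refine Part.ext fun y => ?_
  simp only [Part.mem_bind_iff, hout, Part.mem_some_iff, Part.mem_coe]
  refine exists_congr fun k => and_congr_right fun hk => ?_
  have hk' := Nat.rfind_spec hk
  cases hx : h x (initSeg A k) with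
  | none => simp [hx] at hk'
  | some z => simp [eq_comm]

/-! ### Indices -/

theorem ofNat_pair_index (i j : ℕ) :
    OCode.ofNat (4 * Nat.pair i j + 5) = .pair (OCode.ofNat i) (OCode.ofNat j) := by
  have h2 : (4 * Nat.pair i j).div2 = 2 * Nat.pair i j := by rw [Nat.div2_val]; omega
  have h3 : (2 * Nat.pair i j).div2 = Nat.pair i j := by rw [Nat.div2_val]; omega
  have h4 : (4 * Nat.pair i j).bodd = false := by rw [Nat.bodd_mul]; rfl
  have h5 : (2 * Nat.pair i j).bodd = false := by rw [Nat.bodd_mul]; rfl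
  rw [OCode.ofNat]
  simp only [h2, h3, h4, h5, Nat.unpair_pair]

theorem ofNat_comp_index (i j : ℕ) :
    OCode.ofNat (4 * Nat.pair i j + 2 + 5) = .comp (OCode.ofNat i) (OCode.ofNat j) := by
  have h2 : (4 * Nat.pair i j + 2).div2 = 2 * Nat.pair i j + 1 := by rw [Nat.div2_val]; omega
  have h3 : (2 * Nat.pair i j + 1).div2 = Nat.pair i j := by rw [Nat.div2_val]; omega
  have h4 : (4 * Nat.pair i j + 2).bodd = false := by rw [Nat.bodd_add, Nat.bodd_mul]; rfl
  have h5 : (2 * Nat.pair i j + 1).bodd = true := by rw [Nat.bodd_add, Nat.bodd_mul]; rfl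
  rw [OCode.ofNat]
  simp only [h2, h3, h4, h5, Nat.unpair_pair]

theorem ofNat_prec_index (i j : ℕ) :
    OCode.ofNat (4 * Nat.pair i j + 1 + 5) = .prec (OCode.ofNat i) (OCode.ofNat j) := by
  have h2 : (4 * Nat.pair i j + 1).div2 = 2 * Nat.pair i j := by rw [Nat.div2_val]; omega
  have h3 : (2 * Nat.pair i j).div2 = Nat.pair i j := by rw [Nat.div2_val]; omega
  have h4 : (4 * Nat.pair i j + 1).bodd = true := by rw [Nat.bodd_add, Nat.bodd_mul]; rfl
  have h5 : (2 * Nat.pair i j).bodd = false := by rw [Nat.bodd_mul]; rfl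
  rw [OCode.ofNat]
  simp only [h2, h3, h4, h5, Nat.unpair_pair]

theorem ofNat_rfind'_index (i : ℕ) :
    OCode.ofNat (4 * i + 3 + 5) = .rfind' (OCode.ofNat i) := by
  have h2 : (4 * i + 3).div2 = 2 * i + 1 := by rw [Nat.div2_val]; omega
  have h3 : (2 * i + 1).div2 = i := by rw [Nat.div2_val]; omega
  have h4 : (4 * i + 3).bodd = true := by rw [Nat.bodd_add, Nat.bodd_mul]; rfl
  have h5 : (2 * i + 1).bodd = true := by rw [Nat.bodd_add, Nat.bodd_mul]; rfl
  rw [OCode.ofNat]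
  simp only [h2, h3, h4, h5]

theorem OCode.ofNat_surjective : Function.Surjective OCode.ofNat := by
  intro c
  induction c with
  | zero => exact ⟨0, by rw [OCode.ofNat]⟩
  | succ => exact ⟨1, by rw [OCode.ofNat]⟩
  | left => exact ⟨2, by rw [OCode.ofNat]⟩
  | right => exact ⟨3, by rw [OCode.ofNat]⟩
  | oracle => exact ⟨4, by rw [OCode.ofNat]⟩
  | pair c d hc hd =>
    obtain ⟨i, rfl⟩ := hc
    obtain ⟨j, rfl⟩ := hd
    exact ⟨_, ofNat_pair_index i j⟩
  | comp c d hc hd =>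
    obtain ⟨i, rfl⟩ := hc
    obtain ⟨j, rfl⟩ := hd
    exact ⟨_, ofNat_comp_index i j⟩
  | prec c d hc hd =>
    obtain ⟨i, rfl⟩ := hc
    obtain ⟨j, rfl⟩ := hd
    exact ⟨_, ofNat_prec_index i j⟩
  | rfind' c hc =>
    obtain ⟨i, rfl⟩ := hc
    exact ⟨_, ofNat_rfind'_index i⟩

theorem primrec_comp_index : Primrec₂ fun i j : ℕ => 4 * Nat.pair i j + 2 + 5 :=
  Primrec.nat_add.comp (Primrec.nat_add.comp
    (Primrec.nat_mul.comp (Primrec.const 4) Primrec₂.natPair) (Primrec.const 2)) (Primrec.const 5)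

theorem primrec_pair_index : Primrec₂ fun i j : ℕ => 4 * Nat.pair i j + 5 :=
  Primrec.nat_add.comp
    (Primrec.nat_mul.comp (Primrec.const 4) Primrec₂.natPair) (Primrec.const 5)

theorem exists_index_const :
    ∃ k : ℕ → ℕ, Primrec k ∧ ∀ A e x, evalo A (OCode.ofNat (k e)) x = Part.some e := by
  refine ⟨fun e => Nat.rec 0 (fun _ r => 4 * Nat.pair 1 r + 2 + 5) e,
    Primrec.nat_rec₁ 0 (primrec_comp_index.comp₂ (Primrec₂.const 1) Primrec₂.right),
    fun A e x => ?_⟩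
  induction e with
  | zero => simp [OCode.ofNat, evalo, pure, PFun.pure]
  | succ e ih =>
    simp only [ofNat_comp_index]
    rw [evalo_comp ih]
    simp [OCode.ofNat, evalo]

/-- The parametrised form of `exists_code_rfindOpt`. -/
theorem exists_index_rfindOpt {h : ℕ → ℕ → Str → Option ℕ}
    (hh : Primrec fun p : ℕ × ℕ × Str => h p.1 p.2.1 p.2.2) :
    ∃ f : ℕ → ℕ, Nat.Primrec f ∧ ∀ A e x, evalo A (OCode.ofNat (f e)) x =
      Nat.rfindOpt fun k => h e x (initSeg A k) := by
  have hh' : Primrec₂ fun (n : ℕ) (a : Str) => h n.unpair.1 n.unpair.2 a :=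
    hh.comp (Primrec.pair (Primrec.fst.comp (Primrec.unpair.comp Primrec.fst))
      (Primrec.pair (Primrec.snd.comp (Primrec.unpair.comp Primrec.fst)) Primrec.snd))
  obtain ⟨c, hc⟩ := exists_code_rfindOpt hh'
  obtain ⟨i, rfl⟩ := OCode.ofNat_surjective c
  obtain ⟨l, hl⟩ := OCode.ofNat_surjective (.pair .left .right)
  obtain ⟨k, hk, hke⟩ := exists_index_const
  refine ⟨fun e => 4 * Nat.pair i (4 * Nat.pair (k e) l + 5) + 2 + 5, Primrec.nat_iff.1
    (primrec_comp_index.comp (Primrec.const i) (primrec_pair_index.comp hk (Primrec.const l))),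
    fun A e x => ?_⟩
  have hid : evalo A (OCode.ofNat l) x = Part.some x := by
    rw [hl, evalo_pair (x := x.unpair.1) (y := x.unpair.2) (by simp [evalo]) (by simp [evalo])]
    simp
  rw [ofNat_comp_index, ofNat_pair_index, evalo_comp (evalo_pair (hke A e x) hid), hc]
  simp

theorem rfindOpt_eq_some {f : ℕ → Option ℕ} {y : ℕ} (h : ∀ k, ∀ z ∈ f k, z = y)
    (hk : ∃ k, (f k).isSome) : Nat.rfindOpt f = Part.some y := by
  obtain ⟨k, hk⟩ := hk
  obtain ⟨z, hz⟩ := Option.isSome_iff_exists.1 hk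
  have hd : (Nat.rfindOpt f).Dom := Nat.rfindOpt_dom.2 ⟨k, z, hz⟩
  obtain ⟨w, hw⟩ := Part.dom_iff_mem.1 hd
  obtain ⟨n, hn⟩ := Nat.rfindOpt_spec hw
  rw [Part.eq_some_iff]
  rwa [h n w hn] at hw

/-! ### Evaluation with a finite part of the oracle -/

/-- Replace the oracle instruction by the code `t`. -/
def OCode.subst (t : Code) : OCode → Code
  | .zero => .zero
  | .succ => .succ
  | .left => .left
  | .right => .right
  | .oracle => t
  | .pair c d => .pair (c.subst t) (d.subst t)
  | .comp c d => .comp (c.subst t) (d.subst t)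
  | .prec c d => .prec (c.subst t) (d.subst t)
  | .rfind' c => .rfind' (c.subst t)

theorem mem_map_rfind {p : ℕ → Part ℕ} {m y : ℕ} :
    y ∈ (Nat.rfind fun n => (fun x => decide (x = 0)) <$> p (n + m)).map (· + m) ↔
      ∃ n, y = n + m ∧ 0 ∈ p y ∧ ∀ k < n, ∃ z, z ≠ 0 ∧ z ∈ p (k + m) := by
  rw [Part.mem_map_iff]
  constructor
  · rintro ⟨n, hn, rfl⟩
    obtain ⟨h0, hlt⟩ := Nat.mem_rfind.1 hn
    obtain ⟨x, hx, hx0⟩ := (Part.mem_map_iff _).1 h0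
    refine ⟨n, rfl, of_decide_eq_true hx0 ▸ hx, fun k hk => ?_⟩
    obtain ⟨z, hz, hz0⟩ := (Part.mem_map_iff _).1 (hlt hk)
    exact ⟨z, of_decide_eq_false hz0, hz⟩
  · rintro ⟨n, rfl, h0, hlt⟩
    refine ⟨n, Nat.mem_rfind.2 ⟨(Part.mem_map_iff _).2 ⟨0, h0, by simp⟩, fun {k} hk => ?_⟩, rfl⟩
    obtain ⟨z, hz0, hz⟩ := hlt k hk
    exact (Part.mem_map_iff _).2 ⟨z, hz, decide_eq_false hz0⟩

theorem mem_eval_rfind' {c : Code} {a m y : ℕ} : y ∈ (Code.rfind' c).eval (Nat.pair a m) ↔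
    ∃ n, y = n + m ∧ 0 ∈ c.eval (Nat.pair a y) ∧
      ∀ k < n, ∃ z, z ≠ 0 ∧ z ∈ c.eval (Nat.pair a (k + m)) := by
  rw [← mem_map_rfind (p := fun k => c.eval (Nat.pair a k))]
  simp only [Code.eval, Nat.unpaired, Nat.unpair_pair]

theorem mem_evalo_rfind' {A : ℕ → ℕ} {c : OCode} {a m y : ℕ} :
    y ∈ evalo A (.rfind' c) (Nat.pair a m) ↔
    ∃ n, y = n + m ∧ 0 ∈ evalo A c (Nat.pair a y) ∧
      ∀ k < n, ∃ z, z ≠ 0 ∧ z ∈ evalo A c (Nat.pair a (k + m)) := by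
  rw [← mem_map_rfind (p := fun k => evalo A c (Nat.pair a k))]
  simp only [evalo, Nat.unpaired, Nat.unpair_pair]

theorem subst_sound {A : ℕ → ℕ} {t : Code} (h : ∀ n, ∀ y ∈ t.eval n, y = A n) (c : OCode) :
    ∀ n, ∀ y ∈ (c.subst t).eval n, y ∈ evalo A c n := by
  induction c with
  | zero => exact fun _ _ h => h
  | succ => exact fun _ _ h => h
  | left => exact fun _ _ h => h
  | right => exact fun _ _ h => h
  | oracle => exact fun n y hy => Part.mem_some_iff.2 (h n y hy)
  | pair c d hc hd =>
    intro n y hy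
    rw [evalo_pair_eq]
    simp only [OCode.subst, Code.eval, Seq.seq, Part.map_eq_map] at hy
    simp only [Part.mem_bind_iff, Part.mem_map_iff] at hy ⊢
    obtain ⟨_, ⟨x, hx, rfl⟩, z, hz, rfl⟩ := hy
    exact ⟨x, hc _ _ hx, z, hd _ _ hz, rfl⟩
  | comp c d hc hd =>
    intro n y hy
    obtain ⟨x, hx, hy⟩ := Part.mem_bind_iff.1 hy
    exact Part.mem_bind_iff.2 ⟨x, hd _ _ hx, hc _ _ hy⟩
  | prec c d hc hd =>
    intro n
    rw [← Nat.pair_unpair n]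
    generalize n.unpair.1 = a
    induction n.unpair.2 with
    | zero =>
      simp only [OCode.subst, Code.eval_prec_zero, evalo, Nat.unpaired, Nat.unpair_pair]
      exact hc a
    | succ k ih =>
      intro y hy
      simp only [OCode.subst, Code.eval_prec_succ, evalo, Nat.unpaired, Nat.unpair_pair] at hy ih ⊢
      obtain ⟨x, hx, hy⟩ := Part.mem_bind_iff.1 hy
      exact Part.mem_bind_iff.2 ⟨x, ih _ hx, hd _ _ hy⟩
  | rfind' c hc =>
    intro n y hy
    rw [← Nat.pair_unpair n] at hy ⊢
    obtain ⟨k, hk, h0, hlt⟩ := mem_eval_rfind'.1 hy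
    refine mem_evalo_rfind'.2 ⟨k, hk, hc _ _ h0, fun j hj => ?_⟩
    obtain ⟨z, hz0, hz⟩ := hlt j hj
    exact ⟨z, hz0, hc _ _ hz⟩

/-- An oracle computation only uses a finite part of the oracle, and hence is reproduced by almost
every code in a sequence computing larger and larger parts of it. -/
theorem eventually_mem_subst {A : ℕ → ℕ} {t : ℕ → Code}
    (h : ∀ n, ∀ᶠ k in Filter.atTop, A n ∈ (t k).eval n)
    (c : OCode) : ∀ n, ∀ y ∈ evalo A c n, ∀ᶠ k in Filter.atTop, y ∈ (c.subst (t k)).eval n := by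
  induction c with
  | zero => exact fun _ _ h => .of_forall fun _ => h
  | succ => exact fun _ _ h => .of_forall fun _ => h
  | left => exact fun _ _ h => .of_forall fun _ => h
  | right => exact fun _ _ h => .of_forall fun _ => h
  | oracle =>
    intro n y hy
    obtain rfl := Part.mem_some_iff.1 hy
    exact h n
  | pair c d hc hd =>
    intro n y hy
    rw [evalo_pair_eq] at hy
    simp only [Part.mem_bind_iff, Part.mem_map_iff] at hy
    obtain ⟨x, hx, z, hz, rfl⟩ := hy
    filter_upwards [hc _ _ hx, hd _ _ hz] with k hx hz
    simp only [OCode.subst, Code.eval, Seq.seq, Part.map_eq_map]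
    simp only [Part.mem_bind_iff, Part.mem_map_iff]
    exact ⟨_, ⟨x, hx, rfl⟩, z, hz, rfl⟩
  | comp c d hc hd =>
    intro n y hy
    obtain ⟨x, hx, hy⟩ := Part.mem_bind_iff.1 hy
    filter_upwards [hd _ _ hx, hc _ _ hy] with k hx hy
    exact Part.mem_bind_iff.2 ⟨x, hx, hy⟩
  | prec c d hc hd =>
    intro n
    rw [← Nat.pair_unpair n]
    generalize n.unpair.1 = a
    induction n.unpair.2 with
    | zero =>
      simp only [OCode.subst, Code.eval_prec_zero, evalo, Nat.unpaired, Nat.unpair_pair]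
      exact hc a
    | succ k ih =>
      intro y hy
      simp only [OCode.subst, Code.eval_prec_succ, evalo, Nat.unpaired, Nat.unpair_pair] at hy ih ⊢
      obtain ⟨x, hx, hy⟩ := Part.mem_bind_iff.1 hy
      filter_upwards [ih _ hx, hd _ _ hy] with k hx hy
      exact Part.mem_bind_iff.2 ⟨x, hx, hy⟩
  | rfind' c hc =>
    intro n y hy
    rw [← Nat.pair_unpair n] at hy ⊢
    obtain ⟨m, hm, h0, hlt⟩ := mem_evalo_rfind'.1 hy
    choose! z hz0 hz using hlt
    have hall := (Filter.eventually_all_finite (Set.finite_lt_nat m)).2 fun j hj =>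
      hc _ _ (hz j hj)
    filter_upwards [hc _ _ h0, hall] with k h0 hall
    exact mem_eval_rfind'.2
      ⟨m, hm, h0, fun j hj => ⟨z j, hz0 j hj, hall j hj⟩⟩

theorem exists_lookup_code : ∃ l : Code, ∀ s n, l.eval (Nat.pair s n) =
    ((Denumerable.ofNat (List ℕ) s)[n]? : Option ℕ) := by
  have h : Primrec fun n : ℕ => (Denumerable.ofNat (List ℕ) n.unpair.1)[n.unpair.2]? :=
    Primrec.list_getElem?.comp ((Primrec.ofNat _).comp (Primrec.fst.comp Primrec.unpair))
      (Primrec.snd.comp Primrec.unpair)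
  obtain ⟨l, hl⟩ := Code.exists_code.1 (Partrec.nat_iff.1 h.to_comp.ofOption)
  exact ⟨l, fun s n => by rw [hl]; simp⟩

/-- A code computing the finite partial function whose table of values is `τ`. -/
noncomputable def tableCode (τ : Str) : Code :=
  exists_lookup_code.choose.curry (Encodable.encode τ)

theorem mem_eval_tableCode {τ : Str} {n y : ℕ} : y ∈ (tableCode τ).eval n ↔ τ[n]? = some y := by
  rw [tableCode, Code.eval_curry, exists_lookup_code.choose_spec]
  simp

theorem primrec_tableCode : Primrec tableCode :=
  Code.primrec₂_curry.comp (Primrec.const _) Primrec.encode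

/-- `s` steps of the `c`-th machine on input `x` suffice for it to halt when only the finite part
`τ` of the oracle is available. -/
def HaltsWithin (s : ℕ) (τ : Str) (c x : ℕ) : Prop :=
  (Code.evaln s ((OCode.ofNat c).subst (tableCode τ)) x).isSome

theorem HaltsWithin.mono {s s' : ℕ} {τ : Str} {c x : ℕ} (hs : s ≤ s') (h : HaltsWithin s τ c x) :
    HaltsWithin s' τ c x := by
  obtain ⟨y, hy⟩ := Option.isSome_iff_exists.1 h
  exact Option.isSome_iff_exists.2 ⟨y, Code.evaln_mono hs hy⟩

theorem getElem?_initSeg {A : ℕ → ℕ} {k n : ℕ} :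
    (initSeg A k)[n]? = if n < k then some (A n) else none := by
  simp only [initSeg, List.getElem?_map]
  split_ifs with h
  · rw [List.getElem?_range h]; rfl
  · rw [List.getElem?_eq_none (by simpa using h)]; rfl

theorem dom_of_haltsWithin {A : ℕ → ℕ} {s u c x : ℕ} (h : HaltsWithin s (initSeg A u) c x) :
    (evalo A (OCode.ofNat c) x).Dom := by
  obtain ⟨y, hy⟩ := Option.isSome_iff_exists.1 h
  refine Part.dom_iff_mem.2 ⟨y, subst_sound (fun n y hy => ?_) _ _ _ (Code.evaln_sound hy)⟩
  rw [mem_eval_tableCode, getElem?_initSeg] at hy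
  split_ifs at hy
  exact (Option.some.inj hy).symm

theorem exists_haltsWithin_of_dom {A : ℕ → ℕ} {c x : ℕ} (h : (evalo A (OCode.ofNat c) x).Dom) :
    ∃ s u, HaltsWithin s (initSeg A u) c x := by
  obtain ⟨y, hy⟩ := Part.dom_iff_mem.1 h
  have ht : ∀ n, ∀ᶠ k in Filter.atTop, A n ∈ (tableCode (initSeg A k)).eval n := fun n => by
    filter_upwards [Filter.eventually_gt_atTop n] with k hk
    rw [mem_eval_tableCode, getElem?_initSeg, if_pos hk]
  obtain ⟨u, hu⟩ := (eventually_mem_subst ht _ _ _ hy).exists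
  obtain ⟨s, hs⟩ := Code.evaln_complete.1 hu
  exact ⟨s, u, Option.isSome_iff_exists.2 ⟨y, hs⟩⟩

theorem primrec₂_subst : Primrec₂ fun (t : Code) (n : ℕ) => (OCode.ofNat n).subst t := by
  let g : Code → List Code → Code := fun t l =>
    if l.length < 5 then [Code.zero, .succ, .left, .right, t].getD l.length .zero
    else
      bif (l.length - 5).bodd then
        bif (l.length - 5).div2.bodd then .rfind' (l.getD (l.length - 5).div2.div2 .zero)
        else .prec (l.getD (l.length - 5).div2.div2.unpair.1 .zero)
          (l.getD (l.length - 5).div2.div2.unpair.2 .zero)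
      else
        bif (l.length - 5).div2.bodd then .comp (l.getD (l.length - 5).div2.div2.unpair.1 .zero)
          (l.getD (l.length - 5).div2.div2.unpair.2 .zero)
        else .pair (l.getD (l.length - 5).div2.div2.unpair.1 .zero)
          (l.getD (l.length - 5).div2.div2.unpair.2 .zero)
  have hlen : Primrec fun p : Code × List Code => p.2.length :=
    Primrec.list_length.comp Primrec.snd
  have hm : Primrec fun p : Code × List Code => p.2.length - 5 :=
    Primrec.nat_sub.comp hlen (Primrec.const 5)
  have hm2 := Primrec.nat_div2.comp hm
  have hq := Primrec.nat_div2.comp hm2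
  have hl := (Primrec.list_getD Code.zero).comp Primrec.snd
    (Primrec.fst.comp (Primrec.unpair.comp hq))
  have hr := (Primrec.list_getD Code.zero).comp Primrec.snd
    (Primrec.snd.comp (Primrec.unpair.comp hq))
  have hg : Primrec fun p : Code × List Code => g p.1 p.2 := by
    refine Primrec.ite (Primrec.nat_lt.comp hlen (Primrec.const 5)) ?_
      (Primrec.cond (Primrec.nat_bodd.comp hm)
        (Primrec.cond (Primrec.nat_bodd.comp hm2)
          (Code.primrec_rfind'.comp ((Primrec.list_getD Code.zero).comp Primrec.snd hq))
          (Code.primrec₂_prec.comp hl hr))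
        (Primrec.cond (Primrec.nat_bodd.comp hm2)
          (Code.primrec₂_comp.comp hl hr) (Code.primrec₂_pair.comp hl hr)))
    have hc := fun c : Code => (Primrec.const c : Primrec fun _ : Code × List Code => c)
    exact (Primrec.list_getD Code.zero).comp
      (Primrec.list_cons.comp (hc _) (Primrec.list_cons.comp (hc _) (Primrec.list_cons.comp (hc _)
        (Primrec.list_cons.comp (hc _) (Primrec.list_cons.comp Primrec.fst (Primrec.const []))))))
      hlen
  refine Primrec.nat_strong_rec _ (g := fun t l => some (g t l)) (Primrec.option_some.comp hg)
    fun t n => congrArg some ?_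
  have hget : ∀ i < n, ((List.range n).map fun j => (OCode.ofNat j).subst t).getD i .zero =
      (OCode.ofNat i).subst t := by
    intro i hi
    simp [List.getD, List.getElem?_range hi]
  match n with
  | 0 => simp [g, OCode.ofNat, OCode.subst]
  | 1 => simp [g, OCode.ofNat, OCode.subst]
  | 2 => simp [g, OCode.ofNat, OCode.subst]
  | 3 => simp [g, OCode.ofNat, OCode.subst]
  | 4 => simp [g, OCode.ofNat, OCode.subst]
  | m + 5 =>
    have hq : m.div2.div2 < m + 5 := by simp only [Nat.div2_val]; omega
    have h1 := hget _ (lt_of_le_of_lt (Nat.unpair_left_le m.div2.div2) hq)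
    have h2 := hget _ (lt_of_le_of_lt (Nat.unpair_right_le m.div2.div2) hq)
    have h3 := hget _ hq
    rw [OCode.ofNat]
    simp only [g, List.length_map, List.length_range, Nat.add_sub_cancel, h1, h2, h3,
      if_neg (show ¬ m + 5 < 5 by omega)]
    cases m.bodd <;> cases m.div2.bodd <;> rfl

theorem primrecPred_haltsWithin {α : Type*} [Primcodable α] {s c x : α → ℕ} {τ : α → Str}
    (hs : Primrec s) (hτ : Primrec τ) (hc : Primrec c) (hx : Primrec x) :
    PrimrecPred fun p => HaltsWithin (s p) (τ p) (c p) (x p) := by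
  refine Primrec.primrecPred ?_
  refine (Primrec.option_isSome.comp (Code.primrec_evaln.comp (Primrec.pair (Primrec.pair hs
    (primrec₂_subst.comp (primrec_tableCode.comp hτ) hc)) hx))).of_eq fun p => ?_
  rw [Bool.eq_iff_iff, decide_eq_true_iff]
  rfl

/-! ### Approximating the jump -/

/-- The finite part `a` of an oracle already shows that `i` belongs to the jump of the oracle. -/
def JumpStage (a : Str) (i : ℕ) : Prop :=
  ∃ k < a.length, HaltsWithin k.unpair.1 (a.take k.unpair.2) i i

/-- The first `u` values of the approximation to the jump given by a finite part of the oracle. -/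
noncomputable def jumpApprox (a : Str) (u : ℕ) : Str :=
  (List.range u).map fun i => if JumpStage a i then 1 else 0

@[simp] theorem length_initSeg (X : ℕ → ℕ) (n : ℕ) : (initSeg X n).length = n := by
  simp [initSeg]

theorem take_initSeg (X : ℕ → ℕ) (m n : ℕ) : (initSeg X n).take m = initSeg X (min m n) := by
  simp [initSeg, ← List.map_take, List.take_range]

theorem jumpStage_initSeg {A : ℕ → ℕ} {n i : ℕ} : JumpStage (initSeg A n) i ↔
    ∃ k < n, HaltsWithin k.unpair.1 (initSeg A k.unpair.2) i i := by
  simp only [JumpStage, length_initSeg, take_initSeg]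
  refine exists_congr fun k => and_congr_right fun hk => ?_
  rw [min_eq_left ((Nat.unpair_right_le k).trans hk.le)]

theorem JumpStage.mono {A : ℕ → ℕ} {m n i : ℕ} (hmn : m ≤ n) (h : JumpStage (initSeg A m) i) :
    JumpStage (initSeg A n) i := by
  rw [jumpStage_initSeg] at h ⊢
  obtain ⟨k, hk, h⟩ := h
  exact ⟨k, hk.trans_le hmn, h⟩

theorem exists_jumpStage_iff {A : ℕ → ℕ} {i : ℕ} :
    (∃ n, JumpStage (initSeg A n) i) ↔ (evalo A (OCode.ofNat i) i).Dom := by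
  simp only [jumpStage_initSeg]
  constructor
  · rintro ⟨n, k, -, h⟩
    exact dom_of_haltsWithin h
  · intro h
    obtain ⟨s, u, h⟩ := exists_haltsWithin_of_dom h
    exact ⟨Nat.pair s u + 1, Nat.pair s u, Nat.lt_succ_self _, by simpa using h⟩

theorem initSeg_jump (A : ℕ → ℕ) (u : ℕ) : initSeg (jump A) u =
    (List.range u).map fun i => if ∃ n, JumpStage (initSeg A n) i then 1 else 0 := by
  simp only [exists_jumpStage_iff]
  rfl

theorem jumpApprox_eq_jump_iff {A : ℕ → ℕ} {a : Str} {u : ℕ} : jumpApprox a u = initSeg (jump A) u ↔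
    ∀ i < u, (JumpStage a i ↔ ∃ n, JumpStage (initSeg A n) i) := by
  simp only [initSeg_jump, jumpApprox, List.map_inj_left, List.mem_range]
  refine forall₂_congr fun i _ => ?_
  by_cases h1 : JumpStage a i <;> by_cases h2 : ∃ n, JumpStage (initSeg A n) i <;> simp [h1, h2]

theorem eventually_jumpApprox (A : ℕ → ℕ) (u : ℕ) :
    ∀ᶠ n in Filter.atTop, jumpApprox (initSeg A n) u = initSeg (jump A) u := by
  simp only [jumpApprox_eq_jump_iff]
  refine (Filter.eventually_all_finite (Set.finite_lt_nat u)).2 fun i _ => ?_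
  by_cases h : ∃ n, JumpStage (initSeg A n) i
  · obtain ⟨n, hn⟩ := h
    filter_upwards [Filter.eventually_ge_atTop n] with m hm
    exact iff_of_true (hn.mono hm) ⟨n, hn⟩
  · exact .of_forall fun m => iff_of_false (fun hm => h ⟨m, hm⟩) h

theorem primrecRel_exists_lt {β : Type*} [Primcodable β] {R : ℕ → β → Prop} (hR : PrimrecRel R) :
    PrimrecRel fun n b => ∃ k < n, R k b :=
  (hR.exists_mem_list.comp (Primrec.list_range.comp Primrec.fst) Primrec.snd).of_eq (by simp)

theorem primrecRel_forall_lt {β : Type*} [Primcodable β] {R : ℕ → β → Prop} (hR : PrimrecRel R) :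
    PrimrecRel fun n b => ∀ k < n, R k b :=
  (hR.forall_mem_list.comp (Primrec.list_range.comp Primrec.fst) Primrec.snd).of_eq (by simp)

theorem primrecRel_jumpStage : PrimrecRel JumpStage := by
  have h : PrimrecRel fun (k : ℕ) (p : Str × ℕ) =>
      HaltsWithin k.unpair.1 (p.1.take k.unpair.2) p.2 p.2 := by
    have hk : Primrec fun p : ℕ × Str × ℕ => p.1.unpair := Primrec.unpair.comp Primrec.fst
    have hi : Primrec fun p : ℕ × Str × ℕ => p.2.2 := Primrec.snd.comp Primrec.snd
    exact (primrecPred_haltsWithin (Primrec.fst.comp hk) (Primrec.list_take.comp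
      (Primrec.snd.comp hk) (Primrec.fst.comp Primrec.snd)) hi hi)
  have hex := primrecRel_exists_lt h
  exact PrimrecPred.primrecRel (p := fun p : Str × ℕ => JumpStage p.1 p.2)
    (hex.comp (Primrec.list_length.comp Primrec.fst) (Primrec.id (α := Str × ℕ)))

theorem primrec₂_jumpApprox : Primrec₂ jumpApprox :=
  Primrec.list_map (Primrec.list_range.comp Primrec.snd)
    (Primrec.ite (primrecRel_jumpStage.comp (Primrec.fst.comp Primrec.fst) Primrec.snd)
      (Primrec.const 1) (Primrec.const 0)).to₂

/-! ### The `Π⁰₂` form of membership in a tree recursive in the jump -/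

/-- The `m`-th candidate for a computation showing that an initial segment of `σ` lies in
`W_e^{A'}` is either not a halting computation, or is seen to use incorrect information about `A'` once the
finite part `a` of `A` is known. -/
def Refuted (e : ℕ) (σ : Str) (m : ℕ) (a : Str) : Prop :=
  ¬ HaltsWithin m.unpair.2.unpair.2 (jumpApprox (a.take m.unpair.2.unpair.2) m.unpair.2.unpair.1) e
      (Encodable.encode (σ.take m.unpair.1)) ∨
    jumpApprox a m.unpair.2.unpair.1 ≠
      jumpApprox (a.take m.unpair.2.unpair.2) m.unpair.2.unpair.1

/-- The finite part `a` of the oracle `A` refutes all candidates numbered up to the length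
of `σ`. -/
def Verified (e : ℕ) (σ a : Str) : Prop :=
  σ.length ≤ a.length ∧ ∀ m < σ.length + 1, Refuted e σ m a

theorem exists_verified {A : ℕ → ℕ} {e : ℕ} {σ : Str} (hσ : σ ∈ TA (jump A) e) :
    ∃ k, Verified e σ (initSeg A k) := by
  suffices h : ∀ m, ∀ᶠ k in Filter.atTop, Refuted e σ m (initSeg A k) by
    obtain ⟨k, hk, hm⟩ := ((Filter.eventually_ge_atTop σ.length).and
      ((Filter.eventually_all_finite (Set.finite_lt_nat (σ.length + 1))).2 fun m _ => h m)).exists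
    exact ⟨k, by simpa using hk, hm⟩
  intro m
  simp only [Refuted, take_initSeg]
  generalize m.unpair.2.unpair.1 = u
  generalize m.unpair.2.unpair.2 = s
  filter_upwards [Filter.eventually_ge_atTop s, eventually_jumpApprox A u] with k hk hu
  rw [min_eq_left hk, hu]
  refine or_iff_not_imp_right.2 fun hs hh => ?_
  rw [← not_not.1 hs] at hh
  have hW : σ.take m.unpair.1 ∉ WA (jump A) e := by
    rcases le_total m.unpair.1 σ.length with hl | hl
    · exact hσ _ hl
    · rw [List.take_of_length_le hl]
      simpa using hσ _ le_rfl
  exact hW (dom_of_haltsWithin hh)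

theorem mem_PA_jump_of_verified {A X : ℕ → ℕ} {e : ℕ}
    (h : ∀ n, ∃ k, Verified e (initSeg X (n + 1)) (initSeg A k)) : X ∈ PA (jump A) e := by
  intro N n hn hW
  rw [length_initSeg] at hn
  rw [take_initSeg, min_eq_left hn] at hW
  obtain ⟨s₀, u, hs₀⟩ := exists_haltsWithin_of_dom hW
  obtain ⟨s, hs, hsu, hlim⟩ := ((Filter.eventually_ge_atTop s₀).and
    ((eventually_jumpApprox A u).and
      (Filter.eventually_forall_ge_atTop.2 (eventually_jumpApprox A u)))).exists
  obtain ⟨k, hlen, hm⟩ := h (Nat.pair n (Nat.pair u s))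
  simp only [length_initSeg] at hlen hm
  have hn' : n ≤ Nat.pair n (Nat.pair u s) := Nat.left_le_pair _ _
  have hs' : s ≤ Nat.pair n (Nat.pair u s) :=
    (Nat.right_le_pair _ _).trans (Nat.right_le_pair _ _)
  have := hm (Nat.pair n (Nat.pair u s)) (by omega)
  simp only [Refuted, Nat.unpair_pair, take_initSeg] at this
  rw [min_eq_left (by omega), min_eq_left (by omega), hsu, hlim k (by omega)] at this
  simp [hs₀.mono hs] at this

theorem primrecPred_verified : PrimrecPred fun p : ℕ × Str × Str => Verified p.1 p.2.1 p.2.2 := by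
  have href : PrimrecRel fun (m : ℕ) (p : ℕ × Str × Str) => Refuted p.1 p.2.1 m p.2.2 := by
    have hm : Primrec fun q : ℕ × ℕ × Str × Str => q.1.unpair := Primrec.unpair.comp Primrec.fst
    have hm2 : Primrec fun q : ℕ × ℕ × Str × Str => q.1.unpair.2.unpair :=
      Primrec.unpair.comp (Primrec.snd.comp hm)
    have hu := Primrec.fst.comp hm2
    have hs := Primrec.snd.comp hm2
    have ha : Primrec fun q : ℕ × ℕ × Str × Str => q.2.2.2 :=
      Primrec.snd.comp (Primrec.snd.comp Primrec.snd)
    have hσ : Primrec fun q : ℕ × ℕ × Str × Str => q.2.2.1 :=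
      Primrec.fst.comp (Primrec.snd.comp Primrec.snd)
    have hτ := primrec₂_jumpApprox.comp (Primrec.list_take.comp hs ha) hu
    exact PrimrecPred.or
      (PrimrecPred.not (primrecPred_haltsWithin hs hτ (Primrec.fst.comp Primrec.snd)
        (Primrec.encode.comp (Primrec.list_take.comp (Primrec.fst.comp hm) hσ))))
      (PrimrecPred.not (Primrec.eq.comp (primrec₂_jumpApprox.comp ha hu) hτ))
  have hσ : Primrec fun p : ℕ × Str × Str => p.2.1.length :=
    Primrec.list_length.comp (Primrec.fst.comp Primrec.snd)
  have hall := primrecRel_forall_lt href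
  exact PrimrecPred.and
    (Primrec.nat_le.comp hσ (Primrec.list_length.comp (Primrec.snd.comp Primrec.snd)))
    (hall.comp (Primrec.succ.comp hσ) (Primrec.id (α := ℕ × Str × Str)))

/-! ### The treemap -/

/-- The least length of a finite part of `A` verifying `σ`. -/
noncomputable def stage (A : ℕ → ℕ) (e : ℕ) (σ : Str) : ℕ :=
  sInf {k | Verified e σ (initSeg A k)}

theorem isLeast_stage {A : ℕ → ℕ} {e : ℕ} {σ : Str} (hσ : σ ∈ TA (jump A) e) :
    IsLeast {k | Verified e σ (initSeg A k)} (stage A e σ) :=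
  ⟨Nat.sInf_mem (exists_verified hσ), fun _ hk => Nat.sInf_le hk⟩

/-- The position of the first prefix of `a` verifying `σ`, or the length of `a` if there is none. -/
noncomputable def stageApprox (e : ℕ) (a σ : Str) : ℕ :=
  (List.range a.length).findIdx fun k => Verified e σ (a.take k)

theorem stageApprox_initSeg {A : ℕ → ℕ} {e n s : ℕ} {σ : Str}
    (hs : IsLeast {k | Verified e σ (initSeg A k)} s) :
    stageApprox e (initSeg A n) σ = min s n := by
  have hV : ∀ k < n, (initSeg A n).take k = initSeg A k := fun k hk => by
    rw [take_initSeg, min_eq_left hk.le]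
  rcases lt_or_ge s n with h | h
  · rw [min_eq_left h.le, stageApprox, List.findIdx_eq (by simpa using h)]
    simp only [List.getElem_range, hV s h, decide_eq_true_eq, decide_eq_false_iff_not]
    refine ⟨hs.1, fun j hj hv => ?_⟩
    rw [hV j (hj.trans h)] at hv
    exact absurd (hs.2 hv) (not_le.2 hj)
  · rw [min_eq_right h, stageApprox, List.findIdx_eq_length_of_false] <;> simp only [length_initSeg,
      List.length_range, List.mem_range, decide_eq_false_iff_not]
    intro k hk hv
    rw [hV k hk] at hv
    exact absurd (hs.2 hv) (not_le.2 (hk.trans_le h))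

theorem stageApprox_eq_stage {A : ℕ → ℕ} {e n : ℕ} {σ : Str}
    (h : stageApprox e (initSeg A n) σ < n) :
    stageApprox e (initSeg A n) σ = stage A e σ := by
  have hex : ∃ k, Verified e σ (initSeg A k) := by
    have h' : stageApprox e (initSeg A n) σ < (List.range (initSeg A n).length).length := by simpa
    have := List.findIdx_getElem (w := h')
    simp only [decide_eq_true_eq] at this
    exact ⟨_, by rwa [take_initSeg] at this⟩
  have hs : IsLeast {k | Verified e σ (initSeg A k)} (stage A e σ) :=
    ⟨Nat.sInf_mem hex, fun _ hk => Nat.sInf_le hk⟩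
  rw [stageApprox_initSeg hs] at h ⊢
  omega

/-- Insert after each entry of `σ` the value of `s` at the prefix of `σ` ending with this entry. -/
def interleave (s : Str → ℕ) (σ : Str) : Str :=
  (List.range (2 * σ.length)).map fun i =>
    if i % 2 = 0 then σ.getD (i / 2) 0 else s (σ.take (i / 2 + 1))

/-- The map on Baire space corresponding to `interleave`. -/
def interleavePath (s : Str → ℕ) (X : ℕ → ℕ) (i : ℕ) : ℕ :=
  if i % 2 = 0 then X (i / 2) else s (initSeg X (i / 2 + 1))

theorem getD_initSeg {X : ℕ → ℕ} {i n : ℕ} (h : i < n) : (initSeg X n).getD i 0 = X i := by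
  rw [List.getD, getElem?_initSeg, if_pos h, Option.getD_some]

theorem initSeg_getD (σ : Str) : initSeg (fun i => σ.getD i 0) σ.length = σ := by
  refine List.ext_getElem (by simp) fun i _ h => ?_
  simp [initSeg, List.getD, h]

theorem interleave_initSeg (s : Str → ℕ) (X : ℕ → ℕ) (n : ℕ) :
    interleave s (initSeg X n) = initSeg (interleavePath s X) (2 * n) := by
  rw [interleave, length_initSeg]
  refine List.map_congr_left fun i hi => ?_
  have hi : i / 2 < n := by simp only [List.mem_range] at hi; omega
  rw [interleavePath, getD_initSeg hi, take_initSeg, min_eq_left hi]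

theorem interleave_append (s : Str → ℕ) (σ : Str) (i : ℕ) :
    interleave s (σ ++ [i]) = interleave s σ ++ [i, s (σ ++ [i])] := by
  have h : σ ++ [i] = initSeg (fun j => (σ ++ [i]).getD j 0) (σ.length + 1) := by
    simpa using (initSeg_getD (σ ++ [i])).symm
  have hσ : σ = initSeg (fun j => (σ ++ [i]).getD j 0) σ.length := by
    simpa [take_initSeg] using congrArg (List.take σ.length) h
  conv_lhs => rw [h]
  conv_rhs => rw [h]
  conv in interleave s σ => rw [hσ]
  rw [interleave_initSeg, interleave_initSeg, mul_add, mul_one, initSeg_succ, initSeg_succ,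
    List.append_assoc]
  congr 1
  simp [interleavePath, show (2 * σ.length + 1) % 2 = 1 by omega,
    show (2 * σ.length + 1) / 2 = σ.length by omega]

theorem pathMap_interleave (s : Str → ℕ) : pathMap (interleave s) = interleavePath s := by
  funext X i
  rw [pathMap, interleave_initSeg, getD_initSeg (by omega)]

theorem continuous_interleavePath (s : Str → ℕ) : Continuous (interleavePath s) := by
  refine continuous_pi fun i => ?_
  by_cases h : i % 2 = 0
  · simpa only [interleavePath, h, if_true] using continuous_apply _
  · simp only [interleavePath, h, if_false]
    have : Continuous fun (X : ℕ → ℕ) (j : Fin (i / 2 + 1)) => X j :=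
      continuous_pi fun j => continuous_apply _
    refine ((continuous_of_discreteTopology
      (f := fun Y : Fin (i / 2 + 1) → ℕ => s (List.ofFn Y))).comp this).congr fun X => ?_
    exact congrArg s (List.ext_getElem (by simp) fun j _ _ => by simp [initSeg, -List.ofFn_succ])

/-- The entries of `ρ` at the positions of parity `r`. -/
def alternate (r : ℕ) (ρ : Str) : Str :=
  (List.range (ρ.length / 2)).map fun j => ρ.getD (2 * j + r) 0

theorem alternate_initSeg {r : ℕ} (hr : r < 2) (Y : ℕ → ℕ) (n : ℕ) :
    alternate r (initSeg Y n) = initSeg (fun j => Y (2 * j + r)) (n / 2) := by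
  rw [alternate, length_initSeg, initSeg]
  refine List.map_congr_left fun j hj => getD_initSeg ?_
  rw [List.mem_range] at hj
  omega

theorem primrec_alternate (r : ℕ) : Primrec (alternate r) :=
  Primrec.list_map (Primrec.list_range.comp (Primrec.nat_div.comp Primrec.list_length
    (Primrec.const 2))) ((Primrec.list_getD 0).comp Primrec.fst (Primrec.nat_add.comp
      (Primrec.nat_mul.comp (Primrec.const 2) Primrec.snd) (Primrec.const r)))

/-- The finite part `a` of the oracle shows that the last odd-position entry of `ρ` is not the stage
of the string of its even-position entries. -/
def Mismatch (e : ℕ) (ρ a : Str) : Prop :=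
  2 ≤ ρ.length ∧
    (a.length = ρ.getD (2 * (ρ.length / 2) - 1) 0 ∧ ¬ Verified e (alternate 0 ρ) a ∨
      a.length < ρ.getD (2 * (ρ.length / 2) - 1) 0 ∧ Verified e (alternate 0 ρ) a)

theorem forall_not_mismatch_iff {A Y : ℕ → ℕ} {e n : ℕ} :
    (∀ k, ¬ Mismatch e (initSeg Y n) (initSeg A k)) ↔ (2 ≤ n →
      IsLeast {k | Verified e (initSeg (fun j => Y (2 * j)) (n / 2)) (initSeg A k)}
        (Y (2 * (n / 2) - 1))) := by
  by_cases hn : 2 ≤ n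
  · simp only [Mismatch, alternate_initSeg two_pos, length_initSeg, hn, true_and, add_zero,
      getD_initSeg (show 2 * (n / 2) - 1 < n by omega), forall_const]
    simp only [IsLeast, lowerBounds, Set.mem_ofPred_eq, not_or, not_and, not_not, forall_and,
      forall_eq]
    exact and_congr_right fun _ => forall_congr' fun k =>
      ⟨fun h hv => not_lt.1 fun hl => h hl hv, fun h hl hv => not_lt.2 (h hv) hl⟩
  · simp [Mismatch, hn]

theorem primrecPred_mismatch : PrimrecPred fun p : ℕ × Str × Str => Mismatch p.1 p.2.1 p.2.2 := by
  have hρ : Primrec fun p : ℕ × Str × Str => p.2.1 := Primrec.fst.comp Primrec.snd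
  have ha : Primrec fun p : ℕ × Str × Str => p.2.2 := Primrec.snd.comp Primrec.snd
  have hl := Primrec.list_length.comp hρ
  have hla := Primrec.list_length.comp ha
  have hv := primrecPred_verified.comp
    (Primrec.pair Primrec.fst (Primrec.pair ((primrec_alternate 0).comp hρ) ha))
  have hs := (Primrec.list_getD 0).comp hρ (Primrec.nat_sub.comp (Primrec.nat_mul.comp
    (Primrec.const 2) (Primrec.nat_div.comp hl (Primrec.const 2))) (Primrec.const 1))
  exact (Primrec.nat_le.comp (Primrec.const 2) hl).and
    (((Primrec.eq.comp hla hs).and hv.not).or ((Primrec.nat_lt.comp hla hs).and hv))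

/-- The approximation to `interleave` based on a finite part of the oracle. -/
noncomputable def interleaveApprox (e : ℕ) (σ a : Str) : Option Str :=
  if ∀ j < σ.length, stageApprox e a (σ.take (j + 1)) < a.length then
    some (interleave (stageApprox e a) σ)
  else none

theorem eq_of_mem_interleaveApprox {A : ℕ → ℕ} {e n : ℕ} {σ τ : Str}
    (h : τ ∈ interleaveApprox e σ (initSeg A n)) : τ = interleave (stage A e) σ := by
  rw [interleaveApprox] at h
  split_ifs at h with hs
  · rw [Option.mem_some_iff] at h
    rw [← h]
    refine List.map_congr_left fun i hi => ?_
    rw [List.mem_range] at hi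
    rw [stageApprox_eq_stage (by simpa using hs (i / 2) (by omega))]
  · simp at h

theorem take_mem_TA {A : ℕ → ℕ} {e : ℕ} {σ : Str} (hσ : σ ∈ TA A e) (m : ℕ) :
    σ.take m ∈ TA A e := by
  intro n hn
  rw [List.take_take]
  exact hσ _ ((min_le_left _ _).trans (hn.trans (List.length_take_le' _ _)))

theorem eventually_interleaveApprox {A : ℕ → ℕ} {e : ℕ} {σ : Str} (hσ : σ ∈ TA (jump A) e) :
    ∀ᶠ n in Filter.atTop, interleave (stage A e) σ ∈ interleaveApprox e σ (initSeg A n) := by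
  have h : ∀ᶠ n in Filter.atTop, ∀ j < σ.length, stage A e (σ.take (j + 1)) < n :=
    (Filter.eventually_all_finite (Set.finite_lt_nat _)).2 fun j _ => Filter.eventually_gt_atTop _
  filter_upwards [h] with n hn
  have hs : ∀ j < σ.length, stageApprox e (initSeg A n) (σ.take (j + 1)) <
      (initSeg A n).length := by
    intro j hj
    rw [stageApprox_initSeg (isLeast_stage (take_mem_TA hσ _)), length_initSeg]
    exact (min_le_left _ _).trans_lt (hn j hj)
  have hsome : interleave (stageApprox e (initSeg A n)) σ ∈ interleaveApprox e σ (initSeg A n) := by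
    rw [interleaveApprox, if_pos hs]
    rfl
  rwa [eq_of_mem_interleaveApprox hsome] at hsome

theorem primrec_stageApprox :
    Primrec fun p : ℕ × Str × Str => stageApprox p.1 p.2.1 p.2.2 := by
  refine Primrec.list_findIdx (Primrec.list_range.comp (Primrec.list_length.comp
    (Primrec.fst.comp Primrec.snd))) (PrimrecPred.decide ?_)
  exact primrecPred_verified.comp (Primrec.pair (Primrec.fst.comp Primrec.fst)
    (Primrec.pair (Primrec.snd.comp (Primrec.snd.comp Primrec.fst))
      (Primrec.list_take.comp Primrec.snd (Primrec.fst.comp (Primrec.snd.comp Primrec.fst)))))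

theorem primrec_interleaveApprox :
    Primrec fun p : ℕ × Str × Str => interleaveApprox p.1 p.2.1 p.2.2 := by
  have hσ : Primrec fun p : ℕ × Str × Str => p.2.1 := Primrec.fst.comp Primrec.snd
  have ha : Primrec fun p : ℕ × Str × Str => p.2.2 := Primrec.snd.comp Primrec.snd
  have hst : Primrec₂ fun (p : ℕ × Str × Str) (j : ℕ) =>
      stageApprox p.1 p.2.2 (p.2.1.take (j + 1)) :=
    primrec_stageApprox.comp (Primrec.pair (Primrec.fst.comp Primrec.fst)
      (Primrec.pair (ha.comp Primrec.fst)
        (Primrec.list_take.comp (Primrec.succ.comp Primrec.snd) (hσ.comp Primrec.fst))))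
  have hlt : PrimrecRel fun (j : ℕ) (p : ℕ × Str × Str) =>
      stageApprox p.1 p.2.2 (p.2.1.take (j + 1)) < p.2.2.length :=
    Primrec.nat_lt.comp (hst.comp Primrec.snd Primrec.fst)
      (Primrec.list_length.comp (ha.comp Primrec.snd))
  have hhalf : Primrec fun q : (ℕ × Str × Str) × ℕ => q.2 / 2 :=
    Primrec.nat_div.comp Primrec.snd (Primrec.const 2)
  refine Primrec.ite ((primrecRel_forall_lt hlt).comp (Primrec.list_length.comp hσ) Primrec.id)
    (Primrec.option_some.comp (Primrec.list_map (Primrec.list_range.comp (Primrec.nat_mul.comp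
      (Primrec.const 2) (Primrec.list_length.comp hσ))) ?_)) (Primrec.const none)
  exact Primrec.ite (Primrec.eq.comp (Primrec.nat_mod.comp Primrec.snd (Primrec.const 2))
    (Primrec.const 0)) ((Primrec.list_getD 0).comp (hσ.comp Primrec.fst) hhalf)
    (hst.comp Primrec.fst hhalf)

/-! ### Indices and reductions -/

theorem primrec_decode_getD : Primrec fun x : ℕ => ((Encodable.decode x : Option Str).getD []) :=
  Primrec.option_getD.comp Primrec.decode (Primrec.const [])

theorem exists_index_mismatch : ∃ f, Nat.Primrec f ∧ ∀ A e ρ,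
    ρ ∈ WA A (f e) ↔ ∃ k, Mismatch e ρ (initSeg A k) := by
  let h : ℕ → ℕ → Str → Option ℕ := fun e x a =>
    if Mismatch e ((Encodable.decode x : Option Str).getD []) a then some 0 else none
  have hh : Primrec fun p : ℕ × ℕ × Str => h p.1 p.2.1 p.2.2 :=
    Primrec.ite (primrecPred_mismatch.comp (Primrec.pair Primrec.fst (Primrec.pair
      (primrec_decode_getD.comp (Primrec.fst.comp Primrec.snd)) (Primrec.snd.comp Primrec.snd))))
      (Primrec.const (some 0)) (Primrec.const none)
  obtain ⟨f, hf, hfe⟩ := exists_index_rfindOpt hh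
  refine ⟨f, hf, fun A e ρ => ?_⟩
  rw [WA, Set.mem_ofPred_eq, hfe, Nat.rfindOpt_dom]
  refine exists_congr fun k => ?_
  simp only [h, Encodable.encodek, Option.getD_some]
  split_ifs with hm <;> simp [hm]

theorem exists_index_interleave : ∃ g, Nat.Primrec g ∧ ∀ A e, ∀ σ ∈ TA (jump A) e,
    evalo A (OCode.ofNat (g e)) (Encodable.encode σ) =
      Part.some (Encodable.encode (interleave (stage A e) σ)) := by
  let h : ℕ → ℕ → Str → Option ℕ := fun e x a =>
    (interleaveApprox e ((Encodable.decode x : Option Str).getD []) a).map Encodable.encode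
  have hh : Primrec fun p : ℕ × ℕ × Str => h p.1 p.2.1 p.2.2 :=
    Primrec.option_map (primrec_interleaveApprox.comp (Primrec.pair Primrec.fst (Primrec.pair
      (primrec_decode_getD.comp (Primrec.fst.comp Primrec.snd)) (Primrec.snd.comp Primrec.snd))))
      (Primrec.encode.comp Primrec.snd).to₂
  obtain ⟨g, hg, hge⟩ := exists_index_rfindOpt hh
  refine ⟨g, hg, fun A e σ hσ => ?_⟩
  rw [hge]
  simp only [h, Encodable.encodek, Option.getD_some]
  refine rfindOpt_eq_some (fun k z hz => ?_) ?_
  · obtain ⟨τ, hτ, rfl⟩ := Option.mem_map.1 hz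
    rw [eq_of_mem_interleaveApprox hτ]
  · obtain ⟨k, hk⟩ := (eventually_interleaveApprox hσ).exists
    exact ⟨k, by rw [Option.mem_def.1 hk]; rfl⟩

theorem oplus_two_mul (A B : ℕ → ℕ) (n : ℕ) : oplus A B (2 * n) = A n := by
  simp [oplus]

theorem oplus_two_mul_add_one (A B : ℕ → ℕ) (n : ℕ) : oplus A B (2 * n + 1) = B n := by
  simp [oplus, show (2 * n + 1) % 2 = 1 by omega, show (2 * n + 1) / 2 = n by omega]

theorem unifEquivOn_interleavePath (A : ℕ → ℕ) (e : ℕ) :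
    UnifEquivOn (PA (jump A) e) (fun X => oplus X A)
      (fun X => oplus (interleavePath (stage A e) X) A) := by
  let u : ℕ → Str → Option ℕ := fun n o => o[if n % 2 = 0 then 2 * n else n]?
  have hmod : PrimrecPred fun p : ℕ × Str => p.1 % 2 = 0 :=
    Primrec.eq.comp (Primrec.nat_mod.comp Primrec.fst (Primrec.const 2)) (Primrec.const 0)
  have hu : Primrec₂ u := Primrec.list_getElem?.comp Primrec.snd
    (Primrec.ite hmod (Primrec.nat_mul.comp (Primrec.const 2) Primrec.fst) Primrec.fst)
  let v : ℕ → Str → Option ℕ := fun n o =>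
    if n % 2 = 0 then
      if n / 2 + 1 ≤ o.length / 2 then
        (interleaveApprox e ((alternate 0 o).take (n / 2 + 1)) (alternate 1 o)).map
          fun τ => τ.getD (n / 2) 0
      else none
    else o[n]?
  have hhalf : Primrec fun p : ℕ × Str => p.1 / 2 :=
    Primrec.nat_div.comp Primrec.fst (Primrec.const 2)
  have hv : Primrec₂ v := by
    refine Primrec.ite hmod (Primrec.ite (Primrec.nat_le.comp (Primrec.succ.comp hhalf)
      (Primrec.nat_div.comp (Primrec.list_length.comp Primrec.snd) (Primrec.const 2)))
      (Primrec.option_map (primrec_interleaveApprox.comp (Primrec.pair (Primrec.const e)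
        (Primrec.pair (Primrec.list_take.comp (Primrec.succ.comp hhalf)
          ((primrec_alternate 0).comp Primrec.snd)) ((primrec_alternate 1).comp Primrec.snd))))
        ((Primrec.list_getD 0).comp Primrec.snd (hhalf.comp Primrec.fst)).to₂)
      (Primrec.const none)) (Primrec.list_getElem?.comp Primrec.snd Primrec.fst)
  obtain ⟨c, hc⟩ := exists_code_rfindOpt hu
  obtain ⟨d, hd⟩ := exists_code_rfindOpt hv
  refine ⟨c, d, fun X hX => ⟨fun n => ?_, fun n => ?_⟩⟩
  · rw [hc]
    have hval : oplus (interleavePath (stage A e) X) A (if n % 2 = 0 then 2 * n else n) =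
        oplus X A n := by
      split_ifs with h
      · rw [oplus_two_mul, interleavePath, if_pos h, oplus, if_pos h]
      · rw [oplus, if_neg h, oplus, if_neg h]
    refine rfindOpt_eq_some (fun k z hz => ?_)
      ⟨(if n % 2 = 0 then 2 * n else n) + 1, by simp [u]⟩
    simp only [u, getElem?_initSeg] at hz
    rw [hval] at hz
    split_ifs at hz <;> simp_all
  · rw [hd]
    by_cases h : n % 2 = 0
    · have hval : oplus (interleavePath (stage A e) X) A n =
          (interleave (stage A e) (initSeg X (n / 2 + 1))).getD (n / 2) 0 := by
        rw [interleave_initSeg, getD_initSeg (by omega), oplus, if_pos h]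
      simp only [v, if_pos h, alternate_initSeg two_pos, alternate_initSeg one_lt_two,
        length_initSeg, oplus_two_mul, oplus_two_mul_add_one, add_zero, take_initSeg]
      refine rfindOpt_eq_some (fun k z hz => ?_) ?_
      · split_ifs at hz with hk
        · obtain ⟨τ, hτ, rfl⟩ := Option.mem_map.1 hz
          rw [eq_of_mem_interleaveApprox hτ, min_eq_left hk, hval]
        · simp at hz
      · obtain ⟨m, hm, hle⟩ := ((eventually_interleaveApprox (hX (n / 2 + 1))).and
          (Filter.eventually_ge_atTop (n / 2 + 1))).exists
        refine ⟨2 * m, ?_⟩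
        rw [Nat.mul_div_cancel_left m two_pos, if_pos hle, min_eq_left hle, Option.mem_def.1 hm]
        rfl
    · simp only [v, if_neg h, getElem?_initSeg]
      refine rfindOpt_eq_some (fun k z hz => ?_) ⟨n + 1, by simp⟩
      have hval : oplus X A n = oplus (interleavePath (stage A e) X) A n := by
        rw [oplus, if_neg h, oplus, if_neg h]
      rw [hval] at hz
      split_ifs at hz <;> simp_all

theorem interleavePath_two_mul (s : Str → ℕ) (X : ℕ → ℕ) (i : ℕ) :
    interleavePath s X (2 * i) = X i := by
  simp [interleavePath]

theorem interleavePath_two_mul_add_one (s : Str → ℕ) (X : ℕ → ℕ) (i : ℕ) :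
    interleavePath s X (2 * i + 1) = s (initSeg X (i + 1)) := by
  simp [interleavePath, show (2 * i + 1) % 2 = 1 by omega, show (2 * i + 1) / 2 = i by omega]

theorem initSeg_notMem_WA {A : ℕ → ℕ} {e i : ℕ}
    (hi : ∀ ρ, ρ ∈ WA A i ↔ ∃ k, Mismatch e ρ (initSeg A k)) {Y : ℕ → ℕ} {n : ℕ} :
    initSeg Y n ∉ WA A i ↔ (2 ≤ n →
    IsLeast {k | Verified e (initSeg (fun j => Y (2 * j)) (n / 2)) (initSeg A k)}
      (Y (2 * (n / 2) - 1))) := by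
  rw [hi, not_exists, forall_not_mismatch_iff]

theorem interleave_mem_TA {A : ℕ → ℕ} {e i : ℕ}
    (hi : ∀ ρ, ρ ∈ WA A i ↔ ∃ k, Mismatch e ρ (initSeg A k)) {σ : Str} (hσ : σ ∈ TA (jump A) e) :
    interleave (stage A e) σ ∈ TA A i := by
  intro n hn
  rw [← initSeg_getD σ, interleave_initSeg, length_initSeg] at hn
  rw [← initSeg_getD σ, interleave_initSeg, take_initSeg, min_eq_left hn, initSeg_notMem_WA hi]
  intro h2
  simp only [interleavePath_two_mul]
  rw [show 2 * (n / 2) - 1 = 2 * (n / 2 - 1) + 1 by omega, interleavePath_two_mul_add_one,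
    Nat.sub_add_cancel (by omega)]
  refine isLeast_stage ?_
  have := take_mem_TA hσ (n / 2)
  rwa [← initSeg_getD σ, take_initSeg, min_eq_left (by omega)] at this

theorem interleavePath_mem_PA {A : ℕ → ℕ} {e i : ℕ}
    (hi : ∀ ρ, ρ ∈ WA A i ↔ ∃ k, Mismatch e ρ (initSeg A k)) {X : ℕ → ℕ} (hX : X ∈ PA (jump A) e) :
    interleavePath (stage A e) X ∈ PA A i := by
  intro n
  have := take_mem_TA (interleave_mem_TA hi (hX n)) n
  rwa [interleave_initSeg, take_initSeg, min_eq_left (by omega)] at this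

theorem isLeast_of_mem_PA {A : ℕ → ℕ} {e i : ℕ}
    (hi : ∀ ρ, ρ ∈ WA A i ↔ ∃ k, Mismatch e ρ (initSeg A k)) {Y : ℕ → ℕ} (hY : Y ∈ PA A i) (n : ℕ) :
    IsLeast {k | Verified e (initSeg (fun j => Y (2 * j)) (n + 1)) (initSeg A k)}
      (Y (2 * n + 1)) := by
  have h := hY (2 * (n + 1)) _ le_rfl
  rw [length_initSeg, take_initSeg, min_self, initSeg_notMem_WA hi] at h
  simpa [mul_add] using h (by omega)

theorem homeoOn_interleavePath {A : ℕ → ℕ} {e i : ℕ}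
    (hi : ∀ ρ, ρ ∈ WA A i ↔ ∃ k, Mismatch e ρ (initSeg A k)) :
    HomeoOn (interleavePath (stage A e)) (PA (jump A) e) (PA A i) := by
  have hinv : Set.InvOn (fun (Y : ℕ → ℕ) j => Y (2 * j)) (interleavePath (stage A e))
      (PA (jump A) e) (PA A i) := by
    refine ⟨fun X _ => funext (interleavePath_two_mul _ X), fun Y hY => funext fun n => ?_⟩
    rcases Nat.even_or_odd' n with ⟨m, rfl | rfl⟩
    · rw [interleavePath_two_mul]
    · rw [interleavePath_two_mul_add_one]
      exact (isLeast_of_mem_PA hi hY m).csInf_eq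
  exact ⟨hinv.bijOn (fun X => interleavePath_mem_PA hi) fun Y hY =>
      mem_PA_jump_of_verified fun n => ⟨_, (isLeast_of_mem_PA hi hY n).1⟩,
    (continuous_interleavePath _).continuousOn, _, hinv,
    (continuous_pi fun j => continuous_apply _).continuousOn⟩

/-- **Refined Lemma.**  There is a primitive recursive `f` such that, effectively in
`e` (via a primitive recursive index function `g` for the `A`-recursive code of `F`),
one finds an `A`-recursive treemap `F : T_e^{A'} → T_{f(e)}^A` inducing a
homeomorphism of `P_e^{A'}` onto `P_{f(e)}^A` with `X ⊕ A ≡_T F(X) ⊕ A` uniformly for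
all `X ∈ P_e^{A'}`. -/
theorem refined_pi01_base_change :
    ∃ f : ℕ → ℕ, Nat.Primrec f ∧ ∃ g : ℕ → ℕ, Nat.Primrec g ∧
      ∀ (A : ℕ → ℕ) (e : ℕ), ∃ F : Str → Str,
        IsTreemapOn (TA (jump A) e) F ∧
        (∀ σ ∈ TA (jump A) e, F σ ∈ TA A (f e)) ∧
        (∀ σ ∈ TA (jump A) e,
          evalo A (OCode.ofNat (g e)) (Encodable.encode σ) =
            Part.some (Encodable.encode (F σ))) ∧
        HomeoOn (pathMap F) (PA (jump A) e) (PA A (f e)) ∧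
        UnifEquivOn (PA (jump A) e) (fun X => oplus X A)
          (fun X => oplus (pathMap F X) A) := by
  obtain ⟨f, hf, hfe⟩ := exists_index_mismatch
  obtain ⟨g, hg, hge⟩ := exists_index_interleave
  refine ⟨f, hf, g, hg, fun A e => ⟨interleave (stage A e), fun σ i _ => ?_,
    fun σ => interleave_mem_TA (hfe A e), hge A e, ?_⟩⟩
  · rw [interleave_append]
    exact ⟨[stage A e (σ ++ [i])], by simp⟩
  · rw [pathMap_interleave]
    exact ⟨homeoOn_interleavePath (hfe A e), unifEquivOn_interleavePath A e⟩

end Harrington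
end

section
/- Let T ⊆ ℕ* be a tree and let F: T → ℕ* be a treemap. Then for every τ ∈ F(T), the minimal σ ∈ T with τ ⊆ F(σ) is a substring of τ; consequently F(T) = {τ : there exists a substring σ of τ with σ ∈ T and τ ⊆ F(σ)}, and hence if T and F are A-recursive then F(T) is an A-recursive tree. -/
namespace Harrington

open scoped Classical

/-! ### Closure properties of relative computability -/

theorem evalo_comp_of_eq {A : ℕ → ℕ} {d : OCode} {n m : ℕ} (c : OCode)
    (h : evalo A d n = Part.some m) : evalo A (OCode.comp c d) n = evalo A c m :=
  (congrArg (Part.bind · (evalo A c)) h).trans (Part.bind_some m _)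

namespace TRedIn

variable {A f g : ℕ → ℕ}

theorem succ : TRedIn Nat.succ A := ⟨OCode.succ, fun _ => rfl⟩

theorem left : TRedIn (fun n => n.unpair.1) A := ⟨OCode.left, fun _ => rfl⟩

theorem right : TRedIn (fun n => n.unpair.2) A := ⟨OCode.right, fun _ => rfl⟩

theorem pair (hf : TRedIn f A) (hg : TRedIn g A) :
    TRedIn (fun n => Nat.pair (f n) (g n)) A := by
  obtain ⟨cf, hf⟩ := hf
  obtain ⟨cg, hg⟩ := hg
  exact ⟨OCode.pair cf cg, fun n => by simp [evalo, hf n, hg n, Seq.seq]⟩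

theorem comp (hf : TRedIn f A) (hg : TRedIn g A) : TRedIn (fun n => f (g n)) A := by
  obtain ⟨cf, hf⟩ := hf
  obtain ⟨cg, hg⟩ := hg
  exact ⟨OCode.comp cf cg, fun n => (evalo_comp_of_eq cf (hg n)).trans (hf _)⟩

theorem prec (hf : TRedIn f A) (hg : TRedIn g A) :
    TRedIn (Nat.unpaired fun a n =>
      n.rec (f a) fun y i => g (Nat.pair a (Nat.pair y i))) A := by
  obtain ⟨cf, hf⟩ := hf
  obtain ⟨cg, hg⟩ := hg
  refine ⟨OCode.prec cf cg, fun n => ?_⟩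
  simp only [evalo, Nat.unpaired]
  induction n.unpair.2 with
  | zero => exact hf _
  | succ k ih => exact (congrArg (Part.bind · _) ih).trans ((Part.bind_some _ _).trans (hg _))

/-- Primitive recursive functions are computable from every oracle. -/
theorem of_primrec (hf : Nat.Primrec f) : TRedIn f A := by
  induction hf with
  | zero => exact ⟨OCode.zero, fun _ => rfl⟩
  | succ => exact succ
  | left => exact left
  | right => exact right
  | pair _ _ hf hg => exact hf.pair hg
  | comp _ _ hf hg => exact hf.comp hg
  | prec _ _ hf hg => exact hf.prec hg

/-- A function that is partially computable where a computable test `f` equals `1` extends to a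
total computable function, marking defined values by adding one. -/
theorem guard {d : OCode} (hf : TRedIn f A) (hf01 : ∀ n, f n = 0 ∨ f n = 1)
    (hd : ∀ n, f n = 1 → evalo A d n = Part.some (g n)) :
    TRedIn (fun n => if f n = 1 then g n + 1 else 0) A := by
  obtain ⟨c, hc⟩ := (of_primrec (A := A) Nat.Primrec.id).pair hf
  refine ⟨OCode.comp (OCode.prec OCode.zero (OCode.comp OCode.succ (OCode.comp d OCode.left))) c,
    fun n => ?_⟩
  rw [evalo_comp_of_eq _ (hc n)]
  rcases hf01 n with h | h
  · simp [evalo, h, pure, PFun.pure]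
  · have hleft : evalo A OCode.left (Nat.pair n (Nat.pair 0 0)) = Part.some n := by simp [evalo]
    have hval : evalo A (OCode.comp OCode.succ (OCode.comp d OCode.left))
        (Nat.pair n (Nat.pair 0 0)) = Part.some (g n + 1) :=
      evalo_comp_of_eq _ ((evalo_comp_of_eq d hleft).trans (hd n h))
    simp only [h, if_true, id]
    refine Eq.trans ?_ hval
    simp only [evalo, Nat.unpaired, Nat.unpair_pair]
    exact Part.bind_some 0 _

end TRedIn

/-- Existential quantification bounded by the input preserves relative computability, the
quantified statement being a primitive recursive relation of the input and a computable function
of the bound variable. -/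
theorem TRedIn.bounded_exists {A g : ℕ → ℕ} {R : ℕ → ℕ → Prop} {P : ℕ → Prop}
    (hR : PrimrecRel R) (hg : TRedIn g A) (hP : ∀ m, P m ↔ ∃ k ≤ m, R m (g k)) :
    TRedIn (fun m => if P m then 1 else 0) A := by
  have hstep : Primrec fun q : ℕ =>
      if R q.unpair.1.unpair.1 q.unpair.2 then 1 else q.unpair.1.unpair.2.unpair.2 := by
    have h1 : Primrec fun q : ℕ => q.unpair.1 := Primrec.fst.comp Primrec.unpair
    have h2 : Primrec fun q : ℕ => q.unpair.2 := Primrec.snd.comp Primrec.unpair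
    exact Primrec.ite (hR.comp (h1.comp h1) h2) (Primrec.const 1) (h2.comp (h2.comp h1))
  have hid : TRedIn id A := of_primrec Nat.Primrec.id
  have hsearch := (of_primrec (A := A) Nat.Primrec.zero).prec
    ((of_primrec (A := A) (Primrec.nat_iff.1 hstep)).comp (hid.pair (hg.comp (left.comp right))))
  have key := hsearch.comp (hid.pair succ)
  convert key using 2 with m
  simp only [Nat.unpaired, Nat.unpair_pair, id]
  have hrec : ∀ n : ℕ, (n.rec 0 fun y i => if R m (g y) then 1 else i : ℕ) =
      if ∃ k < n, R m (g k) then 1 else 0 := by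
    intro n
    induction n with
    | zero => simp
    | succ n ih =>
      simp only [ih, Nat.lt_succ_iff_lt_or_eq, or_and_right, exists_or, exists_eq_left]
      by_cases h : R m (g n) <;> simp [h]
  simpa [Nat.lt_succ_iff, hP] using (hrec m.succ).symm

theorem primrecRel_initialSegment : PrimrecRel fun σ τ : Str => σ <+: τ :=
  (Primrec.eq.comp Primrec.fst
    (Primrec.list_take.comp (Primrec.list_length.comp Primrec.fst) Primrec.snd)).of_eq
    fun _ => List.prefix_iff_eq_take.symm

theorem setRecIn_iff {A : ℕ → ℕ} {T : Set Str} :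
    SetRecIn A T ↔ TRedIn (fun n => chi T (Denumerable.ofNat Str n)) A := by
  constructor
  · rintro ⟨c, hc⟩
    exact ⟨c, fun n => by simpa using hc (Denumerable.ofNat Str n)⟩
  · rintro ⟨c, hc⟩
    exact ⟨c, fun σ => by simpa using hc (Encodable.encode σ)⟩

theorem encode_le_of_sublist {σ τ : Str} (h : σ.Sublist τ) :
    Encodable.encode σ ≤ Encodable.encode τ := by
  induction h with
  | slnil => exact le_rfl
  | cons a _ ih =>
    rw [Encodable.encode_list_cons]
    exact (ih.trans (Nat.right_le_pair _ _)).trans (Nat.le_succ _)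
  | cons_cons a _ ih =>
    rw [Encodable.encode_list_cons, Encodable.encode_list_cons]
    refine Nat.succ_le_succ ?_
    rcases ih.lt_or_eq with h | h
    · exact (Nat.pair_lt_pair_right _ h).le
    · rw [h]

/-! ### Treemaps and substrings -/

section Treemap

variable {T : Set Str} {F : Str → Str}

theorem isTree_treeImage : IsTree (treeImage F T) :=
  fun _ _ h ⟨σ, hσ, hτ⟩ => ⟨σ, hσ, h.trans hτ⟩

theorem IsTreemapOn.sublist (hT : IsTree T) (hF : IsTreemapOn T F) {σ : Str} (hσ : σ ∈ T) :
    σ.Sublist (F σ) := by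
  induction σ using List.reverseRecOn with
  | nil => exact List.nil_sublist _
  | append_singleton σ i ih =>
    exact ((ih (hT _ _ (List.prefix_append _ _) hσ)).append_right [i]).trans
      (hF σ i hσ).sublist

theorem IsTreemapOn.sublist_of_minimal (hT : IsTree T) (hF : IsTreemapOn T F) {σ τ : Str}
    (hσ : σ ∈ T) (hτ : τ <+: F σ)
    (hmin : ∀ σ' : Str, σ' <+: σ → σ' ≠ σ → ¬ (σ' ∈ T ∧ τ <+: F σ')) : σ.Sublist τ := by
  rcases σ.eq_nil_or_concat' with rfl | ⟨σ, i, rfl⟩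
  · exact List.nil_sublist _
  have hpre : σ <+: σ ++ [i] := List.prefix_append _ _
  have hσT := hT _ _ hpre hσ
  have hnot : ¬ τ <+: F σ := fun h => hmin σ hpre (by simp) ⟨hσT, h⟩
  have hsub : F σ ++ [i] <+: τ := by
    rcases List.prefix_or_prefix_of_prefix hτ (hF σ i hσ) with h | h
    · rcases List.prefix_concat_iff.1 h with rfl | h
      · exact List.prefix_rfl
      · exact absurd h hnot
    · exact h
  exact ((hF.sublist hT hσT).append_right [i]).trans hsub.sublist

theorem IsTreemapOn.exists_sublist (hT : IsTree T) (hF : IsTreemapOn T F) {τ : Str}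
    (hτ : τ ∈ treeImage F T) : ∃ σ : Str, σ.Sublist τ ∧ σ ∈ T ∧ τ <+: F σ := by
  obtain ⟨σ, ⟨hσ, hτσ⟩, hmin⟩ := WellFounded.has_min (measure (List.length (α := ℕ))).wf
    {σ : Str | σ ∈ T ∧ τ <+: F σ} hτ
  refine ⟨σ, hF.sublist_of_minimal hT hσ hτσ fun σ' h hne h' => hmin σ' h' ?_, hσ, hτσ⟩
  exact lt_of_le_of_ne h.length_le fun hl => hne (h.eq_of_length hl)

theorem IsTreemapOn.treeImage_eq (hT : IsTree T) (hF : IsTreemapOn T F) :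
    treeImage F T = {τ | ∃ σ : Str, σ.Sublist τ ∧ σ ∈ T ∧ τ <+: F σ} :=
  Set.Subset.antisymm (fun _ hτ => hF.exists_sublist hT hτ)
    fun _ ⟨σ, _, hσ, hτ⟩ => ⟨σ, hσ, hτ⟩

theorem IsTreemapOn.setRecIn_treeImage (hT : IsTree T) (hF : IsTreemapOn T F) {A : ℕ → ℕ}
    (hTA : SetRecIn A T) (hFA : FnRecInOn A F T) : SetRecIn A (treeImage F T) := by
  obtain ⟨d, hd⟩ := hFA
  have hchi : ∀ n, chi T (Denumerable.ofNat Str n) = 1 ↔ Denumerable.ofNat Str n ∈ T := by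
    simp [chi]
  have hg := (setRecIn_iff.1 hTA).guard (d := d)
    (g := fun n => Encodable.encode (F (Denumerable.ofNat Str n)))
    (fun n => by unfold chi; split_ifs <;> simp)
    (fun n hn => by simpa using hd _ ((hchi n).1 hn))
  have hR : PrimrecRel fun m v : ℕ =>
      v ≠ 0 ∧ Denumerable.ofNat Str m <+: Denumerable.ofNat Str (v - 1) :=
    (Primrec.eq.comp Primrec.snd (Primrec.const 0)).not.and
      (primrecRel_initialSegment.comp ((Primrec.ofNat Str).comp Primrec.fst)
        ((Primrec.ofNat Str).comp (Primrec.pred.comp Primrec.snd)))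
  rw [setRecIn_iff]
  refine TRedIn.bounded_exists hR hg fun m => ?_
  simp only [hchi]
  constructor
  · intro hm
    obtain ⟨σ, hsub, hσ, hpre⟩ := hF.exists_sublist hT hm
    refine ⟨Encodable.encode σ, by simpa using encode_le_of_sublist hsub, ?_⟩
    simpa [hσ] using hpre
  · rintro ⟨k, -, hk⟩
    by_cases hkT : Denumerable.ofNat Str k ∈ T
    · exact ⟨_, hkT, by simpa [hkT] using hk⟩
    · simp [hkT] at hk

end Treemap

/-- If `T` is a tree and `F` a treemap on `T`, then for `τ ∈ F(T)` any minimal `σ ∈ T`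
with `τ ⊆ F(σ)` is a substring (sublist) of `τ`; consequently `F(T)` is definable with
the existential quantifier bounded to substrings, and hence if `T` and `F` are
`A`-recursive then `F(T)` is an `A`-recursive tree. -/
theorem treemap_image_substring_bound (T : Set Str) (F : Str → Str)
    (hT : IsTree T) (hF : IsTreemapOn T F) :
    (∀ τ ∈ treeImage F T, ∀ σ ∈ T, τ <+: F σ →
      (∀ σ' : Str, σ' <+: σ → σ' ≠ σ → ¬ (σ' ∈ T ∧ τ <+: F σ')) → σ.Sublist τ) ∧
    treeImage F T = {τ | ∃ σ : Str, σ.Sublist τ ∧ σ ∈ T ∧ τ <+: F σ} ∧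
    ∀ A : ℕ → ℕ, SetRecIn A T → FnRecInOn A F T →
      IsTree (treeImage F T) ∧ SetRecIn A (treeImage F T) := by
  exact ⟨fun τ _ σ hσ hτσ hmin => hF.sublist_of_minimal hT hσ hτσ hmin, hF.treeImage_eq hT,
    fun A hTA hFA => ⟨isTree_treeImage, hF.setRecIn_treeImage hT hTA hFA⟩⟩

end Harrington
end
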